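/- Let b(n) be the number of sequences w : Fin n → ℤ with every entry in {-1, -2, 3} and all partial sums Σ_{j<i} w(j) nonnegative (no condition on the total sum). Then b is P-recursive of order at most 21: there exist polynomials q₀, q₁, …, q₂₁ ∈ ℚ[x], not all zero, such that for all n ∈ ℕ, Σ_{i=0}^{21} qᵢ(n)·b(n + i) = 0. -/

import Mathlib

/-- The number of sequences `w : Fin n → ℤ` with every entry in `{-1, -2, 3}`
and all partial sums `Σ_{j<i} w j` (for `i ≤ n`) nonnegative. -/
noncomputable def b (n : ℕ) : ℕ :=
  Nat.card {w : Fin n → ℤ //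
    (∀ i, w i = -1 ∨ w i = -2 ∨ w i = 3) ∧
    (∀ i : ℕ, i ≤ n → 0 ≤ ∑ j ∈ Finset.univ.filter (fun j : Fin n => (j : ℕ) < i), w j)}

/-! ### Part 1: counting walks -/

/-- Walks of length `n` started at height `a`. -/
def walkSet (n : ℕ) (a : ℤ) : Set (Fin n → ℤ) :=
  {w | (∀ i, w i = -1 ∨ w i = -2 ∨ w i = 3) ∧
    (∀ i : ℕ, i ≤ n → 0 ≤ a + ∑ j ∈ Finset.univ.filter (fun j : Fin n => (j : ℕ) < i), w j)}

lemma walkSet_neg (n : ℕ) (a : ℤ) (ha : a < 0) : walkSet n a = ∅ := by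
  ext w
  simp only [walkSet, Set.mem_ofPred_eq, Set.mem_empty_iff_false, iff_false, not_and]
  intro _ h
  have := h 0 (Nat.zero_le _)
  simp at this
  omega

lemma walkSet_zero (a : ℤ) (ha : 0 ≤ a) : walkSet 0 a = Set.univ := by
  ext w
  simp [walkSet, ha]

lemma mem_walkSet_cons (n : ℕ) (a x : ℤ) (w : Fin n → ℤ) (ha : 0 ≤ a) :
    (Fin.cons x w : Fin (n + 1) → ℤ) ∈ walkSet (n + 1) a ↔
      (x = -1 ∨ x = -2 ∨ x = 3) ∧ w ∈ walkSet n (a + x) := by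
  have key : ∀ i : ℕ, ∑ j ∈ Finset.univ.filter (fun j : Fin (n + 1) => (j : ℕ) < i + 1),
      (Fin.cons x w : Fin (n + 1) → ℤ) j
        = x + ∑ j ∈ Finset.univ.filter (fun j : Fin n => (j : ℕ) < i), w j := by
    intro i
    rw [Finset.sum_filter, Finset.sum_filter, Fin.sum_univ_succ]
    simp
  simp only [walkSet, Set.mem_ofPred_eq]
  constructor
  · rintro ⟨h1, h2⟩
    refine ⟨by simpa using h1 0, fun i => by simpa using h1 i.succ, fun i hi => ?_⟩
    have := h2 (i + 1) (by omega)
    rw [key] at this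
    linarith
  · rintro ⟨h0, h1, h2⟩
    refine ⟨fun i => ?_, fun i hi => ?_⟩
    · refine Fin.cases ?_ (fun j => ?_) i
      · simpa using h0
      · simpa using h1 j
    · cases i with
      | zero => simpa using ha
      | succ i =>
        rw [key]
        have := h2 i (by omega)
        linarith

lemma walkSet_succ (n : ℕ) (a : ℤ) (ha : 0 ≤ a) :
    walkSet (n + 1) a =
      ((fun w => (Fin.cons (-1) w : Fin (n + 1) → ℤ)) '' walkSet n (a - 1) ∪
      (fun w => (Fin.cons (-2) w : Fin (n + 1) → ℤ)) '' walkSet n (a - 2)) ∪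
      (fun w => (Fin.cons 3 w : Fin (n + 1) → ℤ)) '' walkSet n (a + 3) := by
  ext w
  obtain ⟨x, v, rfl⟩ : ∃ x v, w = (Fin.cons x v : Fin (n + 1) → ℤ) :=
    ⟨w 0, Fin.tail w, (Fin.cons_self_tail w).symm⟩
  rw [mem_walkSet_cons n a x v ha]
  simp only [Set.mem_union, Set.mem_image, Fin.cons_inj]
  constructor
  · rintro ⟨rfl | rfl | rfl, h⟩
    · exact Or.inl (Or.inl ⟨v, h, rfl, rfl⟩)
    · exact Or.inl (Or.inr ⟨v, h, rfl, rfl⟩)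
    · exact Or.inr ⟨v, h, rfl, rfl⟩
  · rintro ((⟨v, h, rfl, rfl⟩ | ⟨v, h, rfl, rfl⟩) | ⟨v, h, rfl, rfl⟩)
    · exact ⟨by simp, h⟩
    · exact ⟨by simp, h⟩
    · exact ⟨by simp, h⟩

lemma walkSet_finite (n : ℕ) : ∀ a : ℤ, (walkSet n a).Finite := by
  induction n with
  | zero => intro a; exact Set.toFinite _
  | succ n ih =>
    intro a
    by_cases ha : 0 ≤ a
    · rw [walkSet_succ n a ha]
      exact (((ih _).image _).union ((ih _).image _)).union ((ih _).image _)
    · rw [walkSet_neg _ _ (by omega)]; exact Set.finite_empty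

/-- Number of walks of length `n` started at height `a`. -/
noncomputable def walkNum (n : ℕ) (a : ℤ) : ℕ := (walkSet n a).ncard

lemma walkNum_neg (n : ℕ) (a : ℤ) (ha : a < 0) : walkNum n a = 0 := by
  simp [walkNum, walkSet_neg n a ha]

lemma walkNum_zero (a : ℤ) (ha : 0 ≤ a) : walkNum 0 a = 1 := by
  simp [walkNum, walkSet_zero a ha, Set.ncard_univ]

lemma walkNum_succ (n : ℕ) (a : ℤ) (ha : 0 ≤ a) :
    walkNum (n + 1) a = walkNum n (a - 1) + walkNum n (a - 2) + walkNum n (a + 3) := by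
  have hinj : ∀ x : ℤ, Function.Injective (fun w => (Fin.cons x w : Fin (n + 1) → ℤ)) := by
    intro x v w h
    exact (Fin.cons_inj.mp h).2
  have hdis : ∀ x y : ℤ, x ≠ y → ∀ A B : Set (Fin n → ℤ),
      Disjoint ((fun w => (Fin.cons x w : Fin (n + 1) → ℤ)) '' A)
        ((fun w => (Fin.cons y w : Fin (n + 1) → ℤ)) '' B) := by
    intro x y hxy A B
    rw [Set.disjoint_left]
    rintro _ ⟨v, _, rfl⟩ ⟨w, _, h⟩
    exact hxy (Fin.cons_inj.mp h).1.symm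
  have hf := walkSet_finite n
  unfold walkNum
  rw [walkSet_succ n a ha, Set.ncard_union_eq _ (((hf _).image _).union ((hf _).image _))
    ((hf _).image _), Set.ncard_union_eq (hdis _ _ (by norm_num) _ _) ((hf _).image _)
    ((hf _).image _), Set.ncard_image_of_injective _ (hinj _),
    Set.ncard_image_of_injective _ (hinj _), Set.ncard_image_of_injective _ (hinj _)]
  exact Set.disjoint_union_left.mpr ⟨hdis _ _ (by norm_num) _ _, hdis _ _ (by norm_num) _ _⟩

lemma b_eq_walkNum (n : ℕ) : b n = walkNum n 0 := by
  unfold b walkNum walkSet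
  simp only [zero_add]
  rfl

open Polynomial in
/-- The polynomial recording the end heights of the walks of length `n` from `0`. -/
noncomputable def endPoly : ℕ → ℚ[X]
  | 0 => 1
  | n + 1 => endPoly n * X ^ 3 + (endPoly n).divX + (endPoly n).divX.divX

open Polynomial in
/-- Pairing of a polynomial with the walk numbers. -/
noncomputable def pairing (m : ℕ) : ℚ[X] →ₗ[ℚ] ℚ :=
  Polynomial.lsum (fun h => (walkNum m (h : ℤ) : ℚ) • LinearMap.id)

open Polynomial in
lemma pairing_monomial (m h : ℕ) (c : ℚ) :
    pairing m (monomial h c) = walkNum m (h : ℤ) * c := by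
  simp [pairing, Polynomial.lsum_apply, Polynomial.sum_monomial_index]

open Polynomial in
lemma divX_monomial_succ (h : ℕ) (c : ℚ) : (monomial (h + 1) c).divX = monomial h c := by
  ext k
  simp [coeff_divX, coeff_monomial]

open Polynomial in
lemma pairing_step (m : ℕ) (f : ℚ[X]) :
    pairing m (f * X ^ 3 + f.divX + f.divX.divX) = pairing (m + 1) f := by
  induction f using Polynomial.induction_on' with
  | add p q hp hq =>
    rw [map_add (pairing (m + 1)), ← hp, ← hq, ← map_add]
    congr 1
    simp only [divX_add]
    ring
  | monomial h c =>
    have h3 : (monomial h c : ℚ[X]) * X ^ 3 = monomial (h + 3) c := by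
      rw [monomial_mul_X_pow]
    rw [h3, pairing_monomial, walkNum_succ m h (by positivity), map_add, map_add, pairing_monomial]
    match h with
    | 0 =>
      have e : (monomial 0 c : ℚ[X]).divX = 0 := by simp
      rw [e, walkNum_neg _ (((0 : ℕ) : ℤ) - 1) (by norm_num),
        walkNum_neg _ (((0 : ℕ) : ℤ) - 2) (by norm_num)]
      simp
    | 1 =>
      rw [divX_monomial_succ]
      have e : (monomial 0 c : ℚ[X]).divX = 0 := by simp
      rw [e, pairing_monomial, walkNum_neg _ (((1 : ℕ) : ℤ) - 2) (by norm_num)]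
      push_cast
      norm_num
      ring
    | h + 2 =>
      rw [divX_monomial_succ, divX_monomial_succ, pairing_monomial, pairing_monomial]
      have e1 : (((h + 2 : ℕ) : ℤ) - 1) = ((h + 1 : ℕ) : ℤ) := by push_cast; ring
      have e2 : (((h + 2 : ℕ) : ℤ) - 2) = (h : ℤ) := by push_cast; ring
      have e3 : (((h + 2 : ℕ) : ℤ) + 3) = ((h + 2 + 3 : ℕ) : ℤ) := by push_cast; ring
      rw [e1, e2, e3]
      push_cast
      ring

lemma pairing_endPoly (n : ℕ) : ∀ m, pairing m (endPoly n) = walkNum (n + m) 0 := by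
  induction n with
  | zero =>
    intro m
    have : (1 : Polynomial ℚ) = Polynomial.monomial 0 1 := rfl
    rw [endPoly, this, pairing_monomial]
    simp
  | succ n ih =>
    intro m
    rw [endPoly, pairing_step, ih]
    congr 2
    ring

lemma pairing_zero (f : Polynomial ℚ) : pairing 0 f = f.eval 1 := by
  induction f using Polynomial.induction_on' with
  | add p q hp hq => rw [map_add, hp, hq, Polynomial.eval_add]
  | monomial h c => rw [pairing_monomial, walkNum_zero _ (by positivity)]; simp

lemma b_eq_eval (n : ℕ) : (b n : ℚ) = (endPoly n).eval 1 := by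
  rw [← pairing_zero, pairing_endPoly, b_eq_walkNum]
  simp

open Polynomial in
lemma endPoly_rec (n : ℕ) :
    endPoly (n + 1) * X ^ 2 = endPoly n * (X ^ 5 + X + 1)
      - C ((endPoly n).coeff 0 + (endPoly n).coeff 1) * X - C ((endPoly n).coeff 0) := by
  have h1 := divX_mul_X_add (endPoly n)
  have h2 := divX_mul_X_add (endPoly n).divX
  rw [coeff_divX] at h2
  rw [endPoly, C_add]
  simp only [zero_add] at h2
  linear_combination (X + 1) * h1 + X * h2

lemma b_rec (n : ℕ) : (b (n + 1) : ℚ) = 3 * b n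
    - 2 * (endPoly n).coeff 0 - (endPoly n).coeff 1 := by
  have h := congrArg (Polynomial.eval 1) (endPoly_rec n)
  simp at h
  rw [b_eq_eval, b_eq_eval, h]
  ring

/-! ### Part 2: the kernel method -/

section Kernel

open PowerSeries

/-- Sum of the two small roots of the kernel. -/
noncomputable def sS : ℚ⟦X⟧ :=
  X * PowerSeries.mk (fun n => (endPoly n).coeff 0 + (endPoly n).coeff 1)

/-- Product of the two small roots of the kernel. -/
noncomputable def pS : ℚ⟦X⟧ := -(X * PowerSeries.mk (fun n => (endPoly n).coeff 0))

lemma X_mul_mk_sub (c : ℕ → ℚ) (N : ℕ) :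
    (X : ℚ⟦X⟧) ^ N ∣ X * PowerSeries.mk c
      - ∑ n ∈ Finset.range N, X ^ (n + 1) * PowerSeries.C (c n) := by
  induction N with
  | zero => simp
  | succ N _ =>
    rw [PowerSeries.X_pow_dvd_iff]
    intro m hm
    rw [map_sub, map_sum]
    cases m with
    | zero =>
      simp [PowerSeries.coeff_zero_X_mul, pow_succ']
    | succ m =>
      rw [PowerSeries.coeff_succ_X_mul, PowerSeries.coeff_mk]
      rw [Finset.sum_eq_single m]
      · simp [PowerSeries.coeff_X_pow]
      · intro k _ hk
        rw [PowerSeries.coeff_mul_C, PowerSeries.coeff_X_pow, if_neg (by omega), zero_mul]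
      · intro h
        simp at h
        omega

/-- The quadratic algebra containing a formal small root. -/
abbrev KA : Type := QuadraticAlgebra ℚ⟦X⟧ (-pS) sS

noncomputable def tA : KA := algebraMap ℚ⟦X⟧ KA X
noncomputable def uA : KA := ⟨0, 1⟩
noncomputable def fA (n : ℕ) : KA := Polynomial.aeval uA (endPoly n)
noncomputable def eA : KA := uA ^ 2 - tA * (uA ^ 5 + uA + 1)

lemma uA_sq : uA ^ 2 = algebraMap ℚ⟦X⟧ KA sS * uA - algebraMap ℚ⟦X⟧ KA pS := by
  rw [pow_two]
  ext <;> simp [uA]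

lemma fA_rec (n : ℕ) : fA (n + 1) * uA ^ 2 = fA n * (uA ^ 5 + uA + 1)
    - algebraMap ℚ⟦X⟧ KA (PowerSeries.C ((endPoly n).coeff 0 + (endPoly n).coeff 1)) * uA
    - algebraMap ℚ⟦X⟧ KA (PowerSeries.C ((endPoly n).coeff 0)) := by
  have h := congrArg (Polynomial.aeval uA) (endPoly_rec n)
  simp only [map_sub, map_mul, map_add, map_pow, Polynomial.aeval_X, Polynomial.aeval_C,
    map_one] at h
  have e : ∀ c : ℚ, algebraMap ℚ KA c = algebraMap ℚ⟦X⟧ KA (PowerSeries.C c) := fun c => rfl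
  simp only [e] at h
  rw [map_add, map_add]
  exact h

lemma eA_sum (N : ℕ) : eA * ∑ n ∈ Finset.range N, tA ^ n * fA n =
    uA ^ 2 - tA ^ N * fA N * uA ^ 2
    - algebraMap ℚ⟦X⟧ KA (∑ n ∈ Finset.range N, X ^ (n + 1) *
        PowerSeries.C ((endPoly n).coeff 0 + (endPoly n).coeff 1)) * uA
    - algebraMap ℚ⟦X⟧ KA (∑ n ∈ Finset.range N, X ^ (n + 1) *
        PowerSeries.C ((endPoly n).coeff 0)) := by
  induction N with
  | zero => simp [fA, endPoly]
  | succ N ih =>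
    have hm : ∀ a c : ℚ⟦X⟧, algebraMap ℚ⟦X⟧ KA (a + X ^ (N + 1) * c)
        = algebraMap ℚ⟦X⟧ KA a + tA ^ (N + 1) * algebraMap ℚ⟦X⟧ KA c := by
      intro a c
      rw [map_add, map_mul, map_pow]
      rfl
    rw [Finset.sum_range_succ, Finset.sum_range_succ, Finset.sum_range_succ, mul_add, ih,
      hm, hm, eA]
    linear_combination (tA ^ (N + 1)) * fA_rec N

lemma tA_pow_dvd (N : ℕ) : tA ^ N ∣ eA * ∑ n ∈ Finset.range N, tA ^ n * fA n := by
  rw [eA_sum]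
  obtain ⟨r1, h1⟩ := X_mul_mk_sub (fun n => (endPoly n).coeff 0 + (endPoly n).coeff 1) N
  obtain ⟨r2, h2⟩ := X_mul_mk_sub (fun n => (endPoly n).coeff 0) N
  have h1' := congrArg (algebraMap ℚ⟦X⟧ KA) h1
  have h2' := congrArg (algebraMap ℚ⟦X⟧ KA) h2
  rw [map_sub, map_mul _ (X ^ N), map_pow] at h1' h2'
  have e1 : algebraMap ℚ⟦X⟧ KA (X * PowerSeries.mk
    (fun n => (endPoly n).coeff 0 + (endPoly n).coeff 1)) = algebraMap ℚ⟦X⟧ KA sS := rfl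
  have e2 : algebraMap ℚ⟦X⟧ KA (X * PowerSeries.mk
    (fun n => (endPoly n).coeff 0)) = - algebraMap ℚ⟦X⟧ KA pS := by
    rw [← map_neg]
    congr 1
    rw [pS, neg_neg]
  have e : algebraMap ℚ⟦X⟧ KA X = tA := rfl
  rw [e1, e] at h1'
  rw [e2, e] at h2'
  refine ⟨- fA N * uA ^ 2 + algebraMap ℚ⟦X⟧ KA r1 * uA + algebraMap ℚ⟦X⟧ KA r2, ?_⟩
  linear_combination uA_sq + uA * h1' + h2'

lemma tA_pow_dvd_eA (N : ℕ) : tA ^ N ∣ eA := by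
  cases N with
  | zero => simp
  | succ N =>
    have h := tA_pow_dvd (N + 1)
    rw [Finset.sum_range_succ'] at h
    have e : ∑ n ∈ Finset.range N, tA ^ (n + 1) * fA (n + 1)
        = tA * ∑ n ∈ Finset.range N, tA ^ n * fA (n + 1) := by
      rw [Finset.mul_sum]
      refine Finset.sum_congr rfl fun n _ => ?_
      ring
    have e0 : fA 0 = 1 := by simp [fA, endPoly]
    rw [e, e0] at h
    obtain ⟨y, hy⟩ := h
    set Z := ∑ n ∈ Finset.range N, tA ^ n * fA (n + 1)
    have : ∀ k, k ≤ N + 1 → tA ^ k ∣ eA := by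
      intro k
      induction k with
      | zero => simp
      | succ k ih =>
        intro hk
        obtain ⟨z, hz⟩ := ih (by omega)
        obtain ⟨l, hl⟩ : ∃ l, N + 1 = k + 1 + l := ⟨N - k, by omega⟩
        rw [hl, pow_add] at hy
        refine ⟨tA ^ l * y - Z * z, ?_⟩
        linear_combination hy - tA * Z * hz
    exact this _ le_rfl

lemma eq_zero_of_X_pow_dvd (f : ℚ⟦X⟧) (h : ∀ N, (X : ℚ⟦X⟧) ^ N ∣ f) : f = 0 := by
  ext n
  have := (PowerSeries.X_pow_dvd_iff.mp (h (n + 1))) n (by omega)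
  simpa using this

lemma eA_eq_zero : eA = 0 := by
  have h : ∀ N, (X : ℚ⟦X⟧) ^ N ∣ eA.re ∧ (X : ℚ⟦X⟧) ^ N ∣ eA.im := by
    intro N
    rw [← QuadraticAlgebra.algebraMap_dvd_iff, map_pow]
    exact tA_pow_dvd_eA N
  ext1
  · exact eq_zero_of_X_pow_dvd _ fun N => (h N).1
  · exact eq_zero_of_X_pow_dvd _ fun N => (h N).2

lemma kernel_eqs : sS = X * (1 + sS ^ 4 - 3 * sS ^ 2 * pS + pS ^ 2) ∧
    pS = - (X * (1 - pS * sS ^ 3 + 2 * sS * pS ^ 2)) := by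
  have h5 : uA ^ 5 = ⟨-(pS * sS ^ 3) + 2 * sS * pS ^ 2, sS ^ 4 - 3 * sS ^ 2 * pS + pS ^ 2⟩ := by
    have : uA ^ 5 = uA * uA * (uA * uA) * uA := by ring
    rw [this]
    ext1
    · simp [uA]; ring
    · simp [uA]; ring
  have h := eA_eq_zero
  rw [eA, h5, pow_two] at h
  have hre := congrArg QuadraticAlgebra.re h
  have him := congrArg QuadraticAlgebra.im h
  simp [uA, tA, QuadraticAlgebra.re_one, QuadraticAlgebra.im_one] at hre him
  constructor
  · linear_combination him
  · linear_combination -hre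

lemma coeff_one_pS : PowerSeries.coeff 1 pS = -1 := by
  have := PowerSeries.coeff_succ_X_mul 0 (PowerSeries.mk (fun n => (endPoly n).coeff 0))
  rw [zero_add] at this
  rw [pS, map_neg, this]
  simp [endPoly]

/-- The generating function of `b` satisfies `(1 - 3 t) B = 1 - s + p`. -/
lemma gf_b : (1 - 3 * X) * PowerSeries.mk (fun n => (b n : ℚ)) = 1 - sS + pS := by
  have h3 : (3 : ℚ⟦X⟧) = PowerSeries.C 3 := (map_ofNat PowerSeries.C 3).symm
  ext n
  rw [sub_mul, one_mul, mul_assoc, h3, sS, pS]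
  cases n with
  | zero => simp [b_eq_eval, endPoly]
  | succ n =>
    simp only [map_add, map_sub, map_neg, PowerSeries.coeff_C_mul, PowerSeries.coeff_succ_X_mul,
      PowerSeries.coeff_mk, b_rec, PowerSeries.coeff_one]
    simp
    ring

end Kernel

/-! ### Part 3: the hyperelliptic curve and the Euler derivation -/

section Curve

open PowerSeries

lemma X_ne : (X : ℚ⟦X⟧) ≠ 0 := PowerSeries.X_ne_zero

lemma two_ne' : (2 : ℚ⟦X⟧) ≠ 0 := by
  intro h
  have := congrArg PowerSeries.constantCoeff h
  rw [map_ofNat] at this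
  norm_num at this

lemma curve_eq : sS + pS + pS ^ 3 = sS ^ 2 * pS ^ 2 := by
  obtain ⟨h1, h2⟩ := kernel_eqs
  have : (X : ℚ⟦X⟧) * (sS + pS + pS ^ 3 - sS ^ 2 * pS ^ 2) = 0 := by
    linear_combination (-pS) * h1 + sS * h2
  rcases mul_eq_zero.mp this with h | h
  · exact absurd h X_ne
  · linear_combination h

/-- The hyperelliptic coordinate. -/
noncomputable def yS : ℚ⟦X⟧ := 2 * pS ^ 2 * sS - 1

lemma yS_sq : yS ^ 2 = 1 + 4 * pS ^ 3 + 4 * pS ^ 5 := by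
  rw [yS]
  linear_combination (-4 * pS ^ 2) * curve_eq

noncomputable def tS : ℚ⟦X⟧ := (1 + 3 * pS ^ 3 - pS ^ 5) + (1 + pS ^ 3 - pS ^ 5) * yS

lemma X_mul_tS : X * tS = 2 * pS ^ 6 := by
  have h : tS = -2 * pS ^ 5 * (1 + 2 * pS ^ 2 * sS - pS * sS ^ 3) := by
    rw [tS, yS]
    linear_combination (2 * pS ^ 4 * sS + 2 * pS ^ 2) * curve_eq
  rw [h]
  linear_combination (-2 * pS ^ 5) * kernel_eqs.2

lemma pS_ne : pS ≠ 0 := by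
  intro h
  have := coeff_one_pS
  rw [h] at this
  simp at this

lemma constantCoeff_pS : PowerSeries.constantCoeff pS = 0 := by simp [pS]

lemma yS_ne : yS ≠ 0 := by
  intro h
  have := congrArg PowerSeries.constantCoeff h
  simp [yS, constantCoeff_pS] at this

lemma tS_ne : tS ≠ 0 := by
  intro h
  have := X_mul_tS
  rw [h, mul_zero] at this
  exact pS_ne (by simpa [two_ne'] using this.symm)

/-- The Euler derivation. -/
noncomputable def eu : Derivation ℚ ℚ⟦X⟧ ℚ⟦X⟧ := (X : ℚ⟦X⟧) • PowerSeries.derivative ℚ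

lemma eu_X : eu X = X := by simp [eu]

lemma eu_two (f : ℚ⟦X⟧) : eu (2 * f) = 2 * eu f := by
  rw [two_mul, map_add, two_mul]

lemma coeff_eu (f : ℚ⟦X⟧) (n : ℕ) : PowerSeries.coeff n (eu f) = n * PowerSeries.coeff n f := by
  have : eu f = X * PowerSeries.derivative ℚ f := rfl
  rw [this]
  cases n with
  | zero => simp
  | succ n =>
    rw [PowerSeries.coeff_succ_X_mul, PowerSeries.coeff_derivative]
    push_cast
    ring

noncomputable def dT : ℚ⟦X⟧ := 2 * yS * (9 * pS ^ 2 - 5 * pS ^ 4)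
  + 2 * (3 * pS ^ 2 - 5 * pS ^ 4) * (1 + 4 * pS ^ 3 + 4 * pS ^ 5)
  + (1 + pS ^ 3 - pS ^ 5) * (12 * pS ^ 2 + 20 * pS ^ 4)

noncomputable def gS : ℚ⟦X⟧ := pS * dT - 12 * yS * tS

lemma eu_ofNat_mul (n : ℕ) (f : ℚ⟦X⟧) : eu ((n : ℚ⟦X⟧) * f) = n * eu f := by
  rw [Derivation.leibniz, Derivation.map_natCast]
  simp

lemma eu_pow (f : ℚ⟦X⟧) (n : ℕ) : eu (f ^ n) = n * f ^ (n - 1) * eu f := by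
  rw [Derivation.leibniz_pow]
  simp [mul_assoc]

lemma eu_mul (f g : ℚ⟦X⟧) : eu (f * g) = f * eu g + g * eu f := by
  rw [Derivation.leibniz]
  simp

lemma eu_y_rel : 2 * yS * eu yS = (12 * pS ^ 2 + 20 * pS ^ 4) * eu pS := by
  have h := congrArg eu yS_sq
  have e3 := eu_ofNat_mul 4 (pS ^ 3)
  have e5 := eu_ofNat_mul 4 (pS ^ 5)
  push_cast at e3 e5
  rw [map_add, map_add, e3, e5, eu_pow, eu_pow, eu_pow, Derivation.map_one_eq_zero] at h
  push_cast at h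
  linear_combination h

lemma eu_tS : eu tS = (9 * pS ^ 2 - 5 * pS ^ 4) * eu pS
    + (3 * pS ^ 2 - 5 * pS ^ 4) * yS * eu pS + (1 + pS ^ 3 - pS ^ 5) * eu yS := by
  have e3 := eu_ofNat_mul 3 (pS ^ 3)
  push_cast at e3
  rw [tS, map_add, eu_mul, map_sub, map_add, map_sub, map_add, e3, eu_pow, eu_pow,
    Derivation.map_one_eq_zero]
  push_cast
  ring

lemma g_eu_p : gS * eu pS = -2 * yS * pS * tS := by
  have h := congrArg eu X_mul_tS
  rw [eu_mul, eu_X, eu_two, eu_pow, eu_tS] at h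
  push_cast at h
  have hy := eu_y_rel
  have hT := X_mul_tS
  have : (X : ℚ⟦X⟧) * (gS * eu pS + 2 * yS * pS * tS) = 0 := by
    rw [gS, dT]
    linear_combination (2 * yS * pS) * h - (12 * yS * eu pS) * hT
      - (X * pS * (1 + pS ^ 3 - pS ^ 5)) * hy
      - (2 * X * pS * (3 * pS ^ 2 - 5 * pS ^ 4) * eu pS) * yS_sq
  rcases mul_eq_zero.mp this with h | h
  · exact absurd h X_ne
  · linear_combination h

lemma g_eu_y : gS * eu yS = -(12 * pS ^ 2 + 20 * pS ^ 4) * pS * tS := by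
  have : 2 * yS * (gS * eu yS + (12 * pS ^ 2 + 20 * pS ^ 4) * pS * tS) = 0 := by
    linear_combination gS * eu_y_rel + (12 * pS ^ 2 + 20 * pS ^ 4) * g_eu_p
  rcases mul_eq_zero.mp this with h | h
  · rcases mul_eq_zero.mp h with h | h
    · exact absurd h two_ne'
    · exact absurd h yS_ne
  · linear_combination h

lemma gS_ne : gS ≠ 0 := by
  intro h
  have := g_eu_p
  rw [h, zero_mul] at this
  have : (2 : ℚ⟦X⟧) * yS * pS * tS = 0 := by linear_combination this
  exact mul_ne_zero (mul_ne_zero (mul_ne_zero two_ne' yS_ne) pS_ne) tS_ne this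

/-- The unit `X / p`. -/
noncomputable def vS : ℚ⟦X⟧ := (-(PowerSeries.mk (fun n => (endPoly n).coeff 0)))⁻¹

lemma vS_mul_pS : vS * pS = X := by
  have h : PowerSeries.constantCoeff (-(PowerSeries.mk (fun n => (endPoly n).coeff 0))) ≠ 0 := by
    simp [endPoly]
  have h2 := PowerSeries.inv_mul_cancel _ h
  rw [vS, pS]
  linear_combination X * h2

lemma vS_ne : vS ≠ 0 := by
  intro h
  have := vS_mul_pS
  rw [h, zero_mul] at this
  exact X_ne this.symm

lemma g_eu_v : gS * eu vS = vS * (gS + 2 * yS * tS) := by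
  have h := congrArg eu vS_mul_pS
  rw [eu_mul, eu_X] at h
  have : pS * (gS * eu vS - vS * (gS + 2 * yS * tS)) = 0 := by
    linear_combination gS * h - vS * g_eu_p - gS * vS_mul_pS
  rcases mul_eq_zero.mp this with h | h
  · exact absurd h pS_ne
  · linear_combination h

lemma g_eu_mono (n i j : ℕ) : gS * eu (vS ^ n * (pS ^ i * yS ^ j)) =
    vS ^ n * (n * (pS ^ i * yS ^ j) * (gS + 2 * yS * tS)
      - tS * (2 * i * (pS ^ i * yS ^ (j + 1))
        + j * (pS ^ (i + 1) * yS ^ (j - 1)) * (12 * pS ^ 2 + 20 * pS ^ 4))) := by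
  have hn : gS * eu (vS ^ n) = n * vS ^ n * (gS + 2 * yS * tS) := by
    rw [eu_pow]
    cases n with
    | zero => simp
    | succ n =>
      simp only [Nat.add_sub_cancel]
      linear_combination ((n + 1 : ℕ) : ℚ⟦X⟧) * vS ^ n * g_eu_v
  have hi : gS * eu (pS ^ i) = - 2 * i * pS ^ i * yS * tS := by
    rw [eu_pow]
    cases i with
    | zero => simp
    | succ i =>
      simp only [Nat.add_sub_cancel]
      linear_combination ((i + 1 : ℕ) : ℚ⟦X⟧) * pS ^ i * g_eu_p
  have hj : gS * eu (yS ^ j) = - j * yS ^ (j - 1) * (12 * pS ^ 2 + 20 * pS ^ 4) * pS * tS := by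
    rw [eu_pow]
    linear_combination (j : ℚ⟦X⟧) * yS ^ (j - 1) * g_eu_y
  rw [eu_mul, eu_mul]
  linear_combination (pS ^ i * yS ^ j) * hn + vS ^ n * yS ^ j * hi + vS ^ n * pS ^ i * hj

/-- Functions on the curve with bounded pole order at infinity. -/
noncomputable def LS (k : ℕ) : Submodule ℚ ℚ⟦X⟧ :=
  Submodule.span ℚ {f | ∃ i j : ℕ, 2 * i + 5 * j ≤ k ∧ f = pS ^ i * yS ^ j}

lemma mono_mem (i j k : ℕ) (h : 2 * i + 5 * j ≤ k) : pS ^ i * yS ^ j ∈ LS k :=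
  Submodule.subset_span ⟨i, j, h, rfl⟩

lemma p_mem (i k : ℕ) (h : 2 * i ≤ k) : pS ^ i ∈ LS k := by
  simpa using mono_mem i 0 k (by omega)

lemma y_mem (k : ℕ) (h : 5 ≤ k) : yS ∈ LS k := by
  simpa using mono_mem 0 1 k (by omega)

lemma one_mem_LS (k : ℕ) : (1 : ℚ⟦X⟧) ∈ LS k := by
  simpa using mono_mem 0 0 k (by omega)

lemma LS_mono {k l : ℕ} (h : k ≤ l) : LS k ≤ LS l := by
  apply Submodule.span_mono
  rintro f ⟨i, j, hij, rfl⟩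
  exact ⟨i, j, by omega, rfl⟩

lemma mul_mem_LS' {f g : ℚ⟦X⟧} {k l : ℕ} (hf : f ∈ LS k) (hg : g ∈ LS l) :
    f * g ∈ LS (k + l) := by
  have h := Submodule.mul_mem_mul hf hg
  rw [LS, LS, Submodule.span_mul_span] at h
  refine Submodule.span_mono ?_ h
  rintro _ ⟨_, ⟨i, j, hij, rfl⟩, _, ⟨i2, j2, hij2, rfl⟩, rfl⟩
  exact ⟨i + i2, j + j2, by omega, by simp only []; ring⟩

lemma mul_mem_LS {f g : ℚ⟦X⟧} (k l : ℕ) {m : ℕ} (hf : f ∈ LS k) (hg : g ∈ LS l) (h : k + l ≤ m) :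
    f * g ∈ LS m := LS_mono h (mul_mem_LS' hf hg)

lemma nat_mul_mem (n : ℕ) {f : ℚ⟦X⟧} {k : ℕ} (hf : f ∈ LS k) : (n : ℚ⟦X⟧) * f ∈ LS k := by
  rw [← nsmul_eq_mul]
  exact Submodule.smul_of_tower_mem _ n hf

lemma ofNat_mul_mem (n : ℕ) [n.AtLeastTwo] {f : ℚ⟦X⟧} {k : ℕ} (hf : f ∈ LS k) :
    (OfNat.ofNat n : ℚ⟦X⟧) * f ∈ LS k := by
  have := nat_mul_mem (OfNat.ofNat n) hf
  simpa using this

lemma pow_mem_LS {f : ℚ⟦X⟧} {k : ℕ} (hf : f ∈ LS k) (n : ℕ) : f ^ n ∈ LS (k * n) := by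
  induction n with
  | zero => simpa using one_mem_LS _
  | succ n ih =>
    rw [pow_succ]
    exact mul_mem_LS _ _ ih hf (by rw [mul_add, mul_one])

lemma tS_mem : tS ∈ LS 15 := by
  rw [tS]
  refine add_mem (sub_mem (add_mem (one_mem_LS _) (ofNat_mul_mem 3 (p_mem _ _ (by norm_num))))
    (p_mem _ _ (by norm_num))) (mul_mem_LS 10 5 (sub_mem (add_mem (one_mem_LS _)
      (p_mem _ _ (by norm_num))) (p_mem _ _ (by norm_num))) (y_mem _ le_rfl) (by norm_num))

lemma dD_mem : 12 * pS ^ 2 + 20 * pS ^ 4 ∈ LS 8 :=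
  add_mem (ofNat_mul_mem 12 (p_mem _ _ (by norm_num))) (ofNat_mul_mem 20 (p_mem _ _ (by norm_num)))

lemma dT_mem : dT ∈ LS 18 := by
  rw [dT]
  refine add_mem (add_mem ?_ ?_) ?_
  · exact mul_mem_LS 5 8 (ofNat_mul_mem 2 (y_mem _ le_rfl))
      (sub_mem (ofNat_mul_mem 9 (p_mem _ _ (by norm_num)))
      (ofNat_mul_mem 5 (p_mem _ _ (by norm_num)))) (by norm_num)
  · exact mul_mem_LS 8 10 (ofNat_mul_mem 2 (sub_mem (ofNat_mul_mem 3 (p_mem _ _ (by norm_num)))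
      (ofNat_mul_mem 5 (p_mem _ _ (by norm_num)))))
      (add_mem (add_mem (one_mem_LS _) (ofNat_mul_mem 4 (p_mem _ _ (by norm_num))))
      (ofNat_mul_mem 4 (p_mem _ _ (by norm_num)))) (by norm_num)
  · exact mul_mem_LS 10 8 (sub_mem (add_mem (one_mem_LS _)
      (p_mem _ _ (by norm_num))) (p_mem _ _ (by norm_num))) dD_mem (by norm_num)

lemma gS_mem : gS ∈ LS 20 := by
  rw [gS]
  refine sub_mem (mul_mem_LS 2 18 ?_ dT_mem (by norm_num))
    (mul_mem_LS 5 15 (ofNat_mul_mem 12 (y_mem _ le_rfl)) tS_mem (by norm_num))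
  simpa using p_mem 1 2 (by norm_num)

/-- The key estimate on the Euler derivation. -/
lemma g_eu_mem (n k : ℕ) (g : ℚ⟦X⟧) (hg : g ∈ LS k) :
    ∃ h ∈ LS (k + 20), gS * eu (vS ^ n * g) = vS ^ n * h := by
  induction hg using Submodule.span_induction with
  | mem f hf =>
    obtain ⟨i, j, hij, rfl⟩ := hf
    refine ⟨_, ?_, g_eu_mono n i j⟩
    refine sub_mem (mul_mem_LS k 20 (nat_mul_mem n (mono_mem i j k hij)) (add_mem gS_mem
      (mul_mem_LS 5 15 (ofNat_mul_mem 2 (y_mem _ le_rfl)) tS_mem (by norm_num))) le_rfl) ?_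
    refine mul_mem_LS 15 (k + 5) tS_mem (add_mem ?_ ?_) (by omega)
    · rw [mul_assoc]
      exact ofNat_mul_mem 2 (nat_mul_mem i (mono_mem _ _ _ (by omega)))
    · cases j with
      | zero => simp
      | succ j =>
        exact mul_mem_LS (2 * (i + 1) + 5 * j) 8 (nat_mul_mem _ (mono_mem _ _ _ (by simp)))
          dD_mem (by omega)
  | zero => exact ⟨0, zero_mem _, by simp⟩
  | add f g _ _ hf hg =>
    obtain ⟨a, ha, ea⟩ := hf
    obtain ⟨c, hc, ec⟩ := hg
    refine ⟨a + c, add_mem ha hc, ?_⟩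
    rw [mul_add, map_add, mul_add, ea, ec, mul_add]
  | smul r f _ hf =>
    obtain ⟨a, ha, ea⟩ := hf
    refine ⟨r • a, Submodule.smul_mem _ r ha, ?_⟩
    rw [mul_smul_comm, Derivation.map_smul, mul_smul_comm, ea, mul_smul_comm]

/-- The series whose shifts are in our space. -/
lemma shift_mem (j : ℕ) (hj : j ≤ 20) :
    ∃ g ∈ LS 306, X ^ (122 - j) * (1 - sS + pS) = vS ^ 122 * g := by
  obtain ⟨l, hl⟩ : ∃ l, 122 = 6 * j + 2 + l := ⟨120 - 6 * j, by omega⟩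
  obtain ⟨m, hm⟩ : ∃ m, 122 = m + j := ⟨122 - j, by omega⟩
  have hm' : 122 - j = m := by omega
  rw [hm']
  refine ⟨((1 / 2 : ℚ) ^ (j + 1)) • (tS ^ j * pS ^ l * (2 * pS ^ 2 + 2 * pS ^ 3 - 1 - yS)), ?_, ?_⟩
  · refine Submodule.smul_mem _ _ (mul_mem_LS (15 * j + 2 * l) 6 (mul_mem_LS (15 * j) (2 * l)
      (pow_mem_LS tS_mem j) (p_mem _ _ le_rfl) le_rfl) ?_ (by omega))
    exact sub_mem (sub_mem (add_mem (ofNat_mul_mem 2 (p_mem _ _ (by norm_num)))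
      (ofNat_mul_mem 2 (p_mem _ _ (by norm_num)))) (one_mem_LS _)) (y_mem _ (by norm_num))
  · have h2 : (2 : ℚ⟦X⟧) ^ (j + 1) ≠ 0 := pow_ne_zero _ two_ne'
    have hp : pS ^ (6 * j) ≠ 0 := pow_ne_zero _ pS_ne
    have hs : ∀ f : ℚ⟦X⟧, (2 : ℚ⟦X⟧) ^ (j + 1) * (((1 / 2 : ℚ) ^ (j + 1)) • f) = f := by
      intro f
      have : (2 : ℚ⟦X⟧) ^ (j + 1) * (((1 / 2 : ℚ) ^ (j + 1)) • f)
          = ((2 : ℚ) ^ (j + 1) * (1 / 2 : ℚ) ^ (j + 1)) • f := by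
        rw [mul_smul, PowerSeries.smul_eq_C_mul _ ((2 : ℚ) ^ (j + 1)), map_pow, map_ofNat]
      rw [this, ← mul_pow]
      norm_num
    apply mul_left_cancel₀ (mul_ne_zero h2 hp)
    have e1 : (X : ℚ⟦X⟧) ^ j * tS ^ j = 2 ^ j * pS ^ (6 * j) := by
      rw [← mul_pow, X_mul_tS, mul_pow, ← pow_mul]
    have e2 : vS ^ 122 * pS ^ 122 = X ^ 122 := by rw [← mul_pow, vS_mul_pS]
    have e3 : pS ^ 122 = pS ^ (6 * j) * pS ^ 2 * pS ^ l := by rw [hl, pow_add, pow_add]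
    have e4 : (X : ℚ⟦X⟧) ^ 122 = X ^ m * X ^ j := by rw [← pow_add, ← hm]
    have e5 : 2 * pS ^ 2 + 2 * pS ^ 3 - 1 - yS = 2 * (pS ^ 2 * (1 - sS + pS)) := by
      rw [yS]; ring
    rw [e3, e4] at e2
    calc (2 : ℚ⟦X⟧) ^ (j + 1) * pS ^ (6 * j) * (X ^ m * (1 - sS + pS))
        = 2 * X ^ m * (1 - sS + pS) * (2 ^ j * pS ^ (6 * j)) := by ring
      _ = 2 * (1 - sS + pS) * tS ^ j * (X ^ m * X ^ j) := by rw [← e1]; ring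
      _ = vS ^ 122 * pS ^ (6 * j) * (tS ^ j * pS ^ l * (2 * (pS ^ 2 * (1 - sS + pS)))) := by
          rw [← e2]; ring
      _ = _ := by
          rw [← e5]
          conv_lhs => rw [← hs (tS ^ j * pS ^ l * (2 * pS ^ 2 + 2 * pS ^ 3 - 1 - yS))]
          ring

end Curve

/-! ### Part 4: dimension counting -/

section Dim

open scoped PowerSeries

lemma aeval_pS_coeff (k : ℕ) : ∀ A : Polynomial ℚ, Polynomial.aeval pS A = 0 → A.coeff k = 0 := by
  have key : ∀ A : Polynomial ℚ, Polynomial.aeval pS A = 0 →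
      A.coeff 0 = 0 ∧ Polynomial.aeval pS A.divX = 0 := by
    intro A hA
    have h := congrArg (Polynomial.aeval pS) (Polynomial.divX_mul_X_add A)
    rw [hA, map_add, map_mul, Polynomial.aeval_X, Polynomial.aeval_C] at h
    have e : algebraMap ℚ ℚ⟦X⟧ (A.coeff 0) = PowerSeries.C (A.coeff 0) := rfl
    rw [e] at h
    have h0 := congrArg PowerSeries.constantCoeff h
    rw [map_add, map_mul, constantCoeff_pS, mul_zero, zero_add, PowerSeries.constantCoeff_C,
      map_zero] at h0
    refine ⟨h0, ?_⟩
    rw [h0, map_zero, add_zero] at h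
    exact (mul_eq_zero.mp h).resolve_right pS_ne
  induction k with
  | zero => exact fun A hA => (key A hA).1
  | succ k ih =>
    intro A hA
    rw [← Polynomial.coeff_divX]
    exact ih _ (key A hA).2

lemma aeval_pS_inj (A : Polynomial ℚ) (h : Polynomial.aeval pS A = 0) : A = 0 := by
  ext k
  simpa using aeval_pS_coeff k A h

open Polynomial in
lemma curve_inj (A B : ℚ[X]) (h : aeval pS A + aeval pS B * yS = 0) : A = 0 ∧ B = 0 := by
  have h1 : A ^ 2 - B ^ 2 * (4 * X ^ 5 + 4 * X ^ 3 + 1) = 0 := by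
    apply aeval_pS_inj
    simp only [map_sub, map_mul, map_pow, map_add, aeval_X, map_one, map_ofNat]
    linear_combination (aeval pS A - aeval pS B * yS) * h + (aeval pS B) ^ 2 * yS_sq
  have hD : (4 * X ^ 5 + 4 * X ^ 3 + 1 : ℚ[X]).natDegree = 5 := by compute_degree!
  have hD0 : (4 * X ^ 5 + 4 * X ^ 3 + 1 : ℚ[X]) ≠ 0 := by
    intro h0
    rw [h0] at hD
    simp at hD
  have hB : B = 0 := by
    by_contra hB
    have h2 := congrArg natDegree (sub_eq_zero.mp h1)
    rw [natDegree_mul (pow_ne_zero 2 hB) hD0, natDegree_pow, natDegree_pow, hD] at h2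
    omega
  refine ⟨?_, hB⟩
  rw [hB] at h
  apply aeval_pS_inj
  simpa using h

/-- The reduced monomials. -/
noncomputable def famS (a c : ℕ) : Fin a ⊕ Fin c → ℚ⟦X⟧ :=
  Sum.elim (fun i => pS ^ (i : ℕ)) (fun i => pS ^ (i : ℕ) * yS)

open Polynomial in
lemma famS_indep (a c : ℕ) : LinearIndependent ℚ (famS a c) := by
  rw [Fintype.linearIndependent_iff]
  intro g hg
  rw [Fintype.sum_sum_type] at hg
  simp only [famS, Sum.elim_inl, Sum.elim_inr] at hg
  have hc : ∀ (m : ℕ) (u : Fin m → ℚ) (i : Fin m),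
      (∑ k : Fin m, C (u k) * X ^ (k : ℕ) : ℚ[X]).coeff i = u i := by
    intro m u i
    rw [finsetSum_coeff]
    simp only [coeff_C_mul, coeff_X_pow]
    rw [Finset.sum_eq_single i]
    · simp
    · intro k _ hk
      rw [if_neg (fun h => hk (Fin.ext h.symm)), mul_zero]
    · simp
  have hs : ∀ (m : ℕ) (u : Fin m → ℚ),
      aeval pS (∑ k : Fin m, C (u k) * X ^ (k : ℕ) : ℚ[X]) = ∑ k, u k • pS ^ (k : ℕ) := by
    intro m u
    rw [map_sum]
    refine Finset.sum_congr rfl fun k _ => ?_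
    rw [map_mul, aeval_C, map_pow, aeval_X, Algebra.smul_def]
  obtain ⟨hA, hB⟩ := curve_inj (∑ k : Fin a, C (g (Sum.inl k)) * X ^ (k : ℕ))
    (∑ k : Fin c, C (g (Sum.inr k)) * X ^ (k : ℕ)) (by
      rw [hs a (fun k => g (Sum.inl k)), hs c (fun k => g (Sum.inr k)), Finset.sum_mul]
      simpa only [smul_mul_assoc] using hg)
  rintro (i | i)
  · rw [← hc a (fun k => g (Sum.inl k)) i, hA, coeff_zero]
  · rw [← hc c (fun k => g (Sum.inr k)) i, hB, coeff_zero]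

lemma mono_mem_fam (k : ℕ) : ∀ j i : ℕ, 2 * i + 5 * j ≤ k →
    pS ^ i * yS ^ j ∈ Submodule.span ℚ (Set.range (famS (k / 2 + 1) ((k - 3) / 2))) := by
  intro j
  induction j using Nat.strong_induction_on with
  | _ j ih =>
    intro i hij
    match j, ih with
    | 0, _ =>
      exact Submodule.subset_span ⟨Sum.inl ⟨i, by omega⟩, by simp [famS]⟩
    | 1, _ =>
      exact Submodule.subset_span ⟨Sum.inr ⟨i, by omega⟩, by simp [famS]⟩
    | j + 2, ih =>
      have e : pS ^ i * yS ^ (j + 2) = pS ^ i * yS ^ j + (4 : ℚ) • (pS ^ (i + 3) * yS ^ j)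
          + (4 : ℚ) • (pS ^ (i + 5) * yS ^ j) := by
        rw [PowerSeries.smul_eq_C_mul, PowerSeries.smul_eq_C_mul, map_ofNat]
        linear_combination (pS ^ i * yS ^ j) * yS_sq
      rw [e]
      exact add_mem (add_mem (ih j (by omega) _ (by omega))
        (Submodule.smul_mem _ _ (ih j (by omega) _ (by omega))))
        (Submodule.smul_mem _ _ (ih j (by omega) _ (by omega)))

lemma LS_eq (k : ℕ) :
    LS k = Submodule.span ℚ (Set.range (famS (k / 2 + 1) ((k - 3) / 2))) := by
  apply le_antisymm
  · rw [LS, Submodule.span_le]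
    rintro _ ⟨i, j, hij, rfl⟩
    exact mono_mem_fam k j i hij
  · rw [Submodule.span_le]
    rintro _ ⟨i | i, rfl⟩
    · exact p_mem _ _ (by have := i.2; omega)
    · simpa [famS] using mono_mem i 1 k (by have := i.2; omega)

lemma finrank_LS (k : ℕ) : Module.finrank ℚ (LS k) = k / 2 + 1 + (k - 3) / 2 := by
  rw [LS_eq, finrank_span_eq_card (famS_indep _ _)]
  simp

instance (k : ℕ) : FiniteDimensional ℚ (LS k) := by
  rw [LS_eq]
  exact FiniteDimensional.span_of_finite ℚ (Set.finite_range _)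

/-- Multiplication by a nonzero power series. -/
noncomputable def mulL (f : ℚ⟦X⟧) : ℚ⟦X⟧ →ₗ[ℚ] ℚ⟦X⟧ := LinearMap.mulLeft ℚ f

lemma mulL_inj {f : ℚ⟦X⟧} (hf : f ≠ 0) : Function.Injective (mulL f) := by
  intro a c h
  exact mul_left_cancel₀ hf h

/-- The starting space. -/
noncomputable def U0 : Submodule ℚ ℚ⟦X⟧ := (LS 306).map (mulL (vS ^ 122))

/-- The space containing the starting space and its image under the Euler derivation. -/
noncomputable def U1 : Submodule ℚ ℚ⟦X⟧ := ((LS 326).map (mulL (vS ^ 122))).comap (mulL gS)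

lemma finrank_U0 : Module.finrank ℚ U0 = 305 := by
  rw [U0, ← (Submodule.equivMapOfInjective (mulL (vS ^ 122))
    (mulL_inj (pow_ne_zero _ vS_ne)) (LS 306)).finrank_eq, finrank_LS]

lemma U1_map_le : U1.map (mulL gS) ≤ (LS 326).map (mulL (vS ^ 122)) :=
  Submodule.map_comap_le _ _

instance : FiniteDimensional ℚ U1 := by
  have : FiniteDimensional ℚ (U1.map (mulL gS)) := Submodule.finiteDimensional_of_le U1_map_le
  exact Module.Finite.equiv (Submodule.equivMapOfInjective (mulL gS) (mulL_inj gS_ne) U1).symm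

lemma finrank_U1 : Module.finrank ℚ U1 ≤ 325 := by
  rw [(Submodule.equivMapOfInjective (mulL gS) (mulL_inj gS_ne) U1).finrank_eq]
  refine (Submodule.finrank_mono U1_map_le).trans ?_
  refine (Submodule.finrank_map_le _ _).trans ?_
  rw [finrank_LS]

lemma U0_le_U1 : U0 ≤ U1 := by
  rintro _ ⟨g, hg, rfl⟩
  refine ⟨gS * g, mul_mem_LS 20 306 gS_mem hg (by norm_num), ?_⟩
  simp only [mulL, LinearMap.mulLeft_apply]
  ring

lemma eu_U0_le_U1 : U0.map (eu : ℚ⟦X⟧ →ₗ[ℚ] ℚ⟦X⟧) ≤ U1 := by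
  rintro _ ⟨_, ⟨g, hg, rfl⟩, rfl⟩
  obtain ⟨h, hh, e⟩ := g_eu_mem 122 306 g hg
  exact ⟨h, hh, e.symm⟩

/-- Abstract counting argument. -/
lemma counting {M : Type*} [AddCommGroup M] [Module ℚ M] (θ : M →ₗ[ℚ] M) (U V : Submodule ℚ M)
    [FiniteDimensional ℚ V] (hUV : U ≤ V) (hθ : U.map θ ≤ V) (d : ℕ)
    (hd : Module.finrank ℚ V ≤ Module.finrank ℚ U + d) (e : Fin (d + 1) → M) (he : ∀ j, e j ∈ U) :
    ∃ r : ℕ, ∃ c : Fin (r + 1) × Fin (d + 1) → ℚ, (∃ x, c x ≠ 0) ∧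
      ∑ x, c x • (θ ^ (x.1 : ℕ)) (e x.2) = 0 := by
  have : FiniteDimensional ℚ U := Submodule.finiteDimensional_of_le hUV
  obtain ⟨W', hW'⟩ := Submodule.exists_isCompl U
  set W := W' ⊓ V with hW
  have hsup : U ⊔ W = V := by
    rw [hW, ← sup_inf_assoc_of_le _ hUV, hW'.sup_eq_top, top_inf_eq]
  have hinf : U ⊓ W = ⊥ := by
    rw [eq_bot_iff, ← hW'.inf_eq_bot]
    exact inf_le_inf le_rfl inf_le_left
  have hWfd : FiniteDimensional ℚ W := Submodule.finiteDimensional_of_le (inf_le_right)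
  have hWd : Module.finrank ℚ W ≤ d := by
    have := Submodule.finrank_sup_add_finrank_inf_eq U W
    rw [hsup, hinf, finrank_bot] at this
    omega
  obtain ⟨Y, hY0, hY⟩ : ∃ Y : ℕ → Submodule ℚ M, Y 0 = ⊥ ∧
      ∀ r, Y (r + 1) = W ⊔ (Y r).map θ :=
    ⟨fun r => Nat.rec ⊥ (fun _ Z => W ⊔ Z.map θ) r, rfl, fun _ => rfl⟩
  have hYf : ∀ r : ℕ, FiniteDimensional ℚ ↥(Y r) ∧ Module.finrank ℚ ↥(Y r) ≤ d * r := by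
    intro r
    induction r with
    | zero =>
      rw [hY0]
      exact ⟨inferInstance, by simp⟩
    | succ r ih =>
      obtain ⟨h1, h2⟩ := ih
      rw [hY]
      refine ⟨inferInstance, (Submodule.finrank_add_le_finrank_add_finrank _ _).trans ?_⟩
      have := Submodule.finrank_map_le θ (Y r)
      rw [mul_add, mul_one]
      omega
  have hYm : ∀ r, Y r ≤ Y (r + 1) := by
    intro r
    induction r with
    | zero => rw [hY0]; exact bot_le
    | succ r ih =>
      rw [hY, hY (r + 1)]
      exact sup_le_sup le_rfl (Submodule.map_mono ih)
  have hYm' : Monotone Y := monotone_nat_of_le_succ hYm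
  have hmem : ∀ i : ℕ, ∀ x ∈ U, (θ ^ i) x ∈ U ⊔ Y i := by
    intro i x hx
    induction i with
    | zero => exact Submodule.mem_sup_left hx
    | succ i ih =>
      rw [pow_succ', Module.End.mul_apply]
      have h1 : (U ⊔ Y i).map θ ≤ U ⊔ Y (i + 1) := by
        rw [Submodule.map_sup, hY, ← sup_assoc, hsup]
        exact sup_le_sup hθ le_rfl
      exact h1 (Submodule.mem_map_of_mem ih)
  set r := Module.finrank ℚ U with hr
  refine ⟨r, ?_⟩
  have hf := (hYf r).1
  let w : Fin (r + 1) × Fin (d + 1) → ↥(U ⊔ Y r) := fun x =>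
    ⟨(θ ^ (x.1 : ℕ)) (e x.2), sup_le_sup le_rfl (hYm' (by have := x.1.2; omega))
      (hmem _ _ (he x.2))⟩
  have hdep : ¬ LinearIndependent ℚ w := by
    intro hli
    have h1 := hli.fintype_card_le_finrank
    have h2 := Submodule.finrank_add_le_finrank_add_finrank U (Y r)
    have h3 := (hYf r).2
    rw [Fintype.card_prod, Fintype.card_fin, Fintype.card_fin] at h1
    nlinarith
  rw [Fintype.not_linearIndependent_iff] at hdep
  obtain ⟨c, hc, hx⟩ := hdep
  refine ⟨c, hx, ?_⟩
  have := congrArg (Submodule.subtype _) hc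
  rw [map_sum] at this
  simpa [w] using this

lemma coeff_eu_pow (i : ℕ) (f : ℚ⟦X⟧) (N : ℕ) :
    PowerSeries.coeff N (((eu : ℚ⟦X⟧ →ₗ[ℚ] ℚ⟦X⟧) ^ i) f) = (N : ℚ) ^ i * PowerSeries.coeff N f := by
  induction i with
  | zero => simp
  | succ i ih =>
    rw [pow_succ', Module.End.mul_apply]
    have := coeff_eu (((eu : ℚ⟦X⟧ →ₗ[ℚ] ℚ⟦X⟧) ^ i) f) N
    rw [ih] at this
    rw [pow_succ', mul_assoc]
    exact this

open Polynomial in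
lemma rec_c : ∃ Q : Fin 21 → ℚ[X], (∃ j, Q j ≠ 0) ∧ ∀ m : ℕ,
    ∑ j : Fin 21, (Q j).eval (m : ℚ) * PowerSeries.coeff (m + j) (1 - sS + pS) = 0 := by
  obtain ⟨r, c, ⟨x, hx⟩, hc⟩ := counting (eu : ℚ⟦X⟧ →ₗ[ℚ] ℚ⟦X⟧) U0 U1 U0_le_U1 eu_U0_le_U1 20
    (by rw [finrank_U0]; exact finrank_U1)
    (fun j => PowerSeries.X ^ (122 - (j : ℕ)) * (1 - sS + pS)) (by
      intro j
      obtain ⟨g, hg, e⟩ := shift_mem j (by have := j.2; omega)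
      exact ⟨g, hg, e.symm⟩)
  let P : Fin 21 → ℚ[X] := fun j => ∑ i : Fin (r + 1), C (c (i, j)) * X ^ (i : ℕ)
  have hP : P x.2 ≠ 0 := by
    intro h
    apply hx
    have h2 := congrArg (fun f => coeff f (x.1 : ℕ)) h
    simp only [P, finsetSum_coeff, coeff_C_mul, coeff_X_pow, coeff_zero] at h2
    rw [Finset.sum_eq_single x.1] at h2
    · simpa using h2
    · intro k _ hk
      rw [if_neg (fun h => hk (Fin.ext h.symm)), mul_zero]
    · simp
  refine ⟨fun j => (P j).comp (X + C 122), ⟨x.2, ?_⟩, ?_⟩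
  · intro h
    apply hP
    have h3 := congrArg (fun f => f.comp (X - C 122)) h
    simp only [comp_assoc] at h3
    simpa using h3
  · intro m
    have h := congrArg (PowerSeries.coeff (m + 122)) hc
    rw [map_sum, map_zero, Fintype.sum_prod_type, Finset.sum_comm] at h
    rw [← h]
    refine Finset.sum_congr rfl fun j _ => ?_
    have hj : m + 122 = (m + j) + (122 - (j : ℕ)) := by have := j.2; omega
    have e : PowerSeries.coeff (m + 122) (PowerSeries.X ^ (122 - (j : ℕ)) * (1 - sS + pS))
        = PowerSeries.coeff (m + j) (1 - sS + pS) := by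
      rw [hj, PowerSeries.coeff_X_pow_mul]
    rw [eval_comp, eval_finsetSum, Finset.sum_mul]
    refine Finset.sum_congr rfl fun i _ => ?_
    rw [PowerSeries.coeff_smul, coeff_eu_pow, e]
    simp only [eval_mul, eval_C, eval_pow, eval_X, eval_add, smul_eq_mul]
    push_cast
    ring

lemma coeff_c (m : ℕ) :
    PowerSeries.coeff (m + 1) (1 - sS + pS) = (b (m + 1) : ℚ) - 3 * b m := by
  have h3 : (3 : ℚ⟦X⟧) = PowerSeries.C 3 := (map_ofNat PowerSeries.C 3).symm
  rw [← gf_b, sub_mul, one_mul, mul_assoc, h3, map_sub, PowerSeries.coeff_C_mul,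
    PowerSeries.coeff_succ_X_mul, PowerSeries.coeff_mk, PowerSeries.coeff_mk]

end Dim

theorem stmt17 :
    ∃ q : Fin 22 → Polynomial ℚ, (∃ i, q i ≠ 0) ∧
      ∀ n : ℕ, ∑ i : Fin 22, (q i).eval (n : ℚ) * (b (n + (i : ℕ)) : ℚ) = 0 := by
  obtain ⟨Q, ⟨j, hj⟩, hQ⟩ := rec_c
  let R : Fin 21 → Polynomial ℚ := fun j => (Q j).comp (Polynomial.X + Polynomial.C 1)
  have hR : R j ≠ 0 := by
    intro h
    apply hj
    have h3 := congrArg (fun f => f.comp (Polynomial.X - Polynomial.C 1)) h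
    simp only [R, Polynomial.comp_assoc] at h3
    simpa using h3
  let up : Fin 22 → Polynomial ℚ := Fin.cons 0 R
  let dn : Fin 22 → Polynomial ℚ := Fin.snoc R 0
  refine ⟨fun i => up i - 3 * dn i, ?_, ?_⟩
  · by_contra hall
    push Not at hall
    apply hR
    have key : ∀ k : ℕ, ∀ hk : k < 21, R ⟨k, hk⟩ = 0 := by
      intro k
      induction k with
      | zero =>
        intro hk
        have h := hall 0
        have e1 : up 0 = 0 := rfl
        have e2 : dn 0 = R ⟨0, hk⟩ := rfl
        rw [e1, e2, zero_sub, neg_eq_zero] at h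
        exact (mul_eq_zero.mp h).resolve_left (by norm_num)
      | succ k ih =>
        intro hk
        have h := hall ⟨k + 1, by omega⟩
        have e1 : up ⟨k + 1, by omega⟩ = R ⟨k, by omega⟩ := rfl
        have e2 : dn ⟨k + 1, by omega⟩ = R ⟨k + 1, hk⟩ := by
          have := Fin.snoc_castSucc (α := fun _ => Polynomial ℚ) 0 R ⟨k + 1, hk⟩
          exact this
        rw [e1, e2, ih (by omega), zero_sub, neg_eq_zero] at h
        exact (mul_eq_zero.mp h).resolve_left (by norm_num)
    exact key j.1 j.2
  · intro n
    have h := hQ (n + 1)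
    have e1 : ∑ i : Fin 22, (up i).eval (n : ℚ) * (b (n + (i : ℕ)) : ℚ)
        = ∑ i : Fin 21, (R i).eval (n : ℚ) * (b (n + (i : ℕ) + 1) : ℚ) := by
      rw [Fin.sum_univ_succ]
      simp [up, add_assoc]
    have e2 : ∑ i : Fin 22, (dn i).eval (n : ℚ) * (b (n + (i : ℕ)) : ℚ)
        = ∑ i : Fin 21, (R i).eval (n : ℚ) * (b (n + (i : ℕ)) : ℚ) := by
      have hlast : dn (Fin.last 21) = 0 := Fin.snoc_last (α := fun _ => Polynomial ℚ) _ _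
      have hcs : ∀ i : Fin 21, dn i.castSucc = R i :=
        fun i => Fin.snoc_castSucc (α := fun _ => Polynomial ℚ) _ _ i
      rw [Fin.sum_univ_castSucc, hlast]
      simp [hcs]
    have e3 : ∀ i : Fin 22, (up i - 3 * dn i).eval (n : ℚ) * (b (n + (i : ℕ)) : ℚ)
        = (up i).eval (n : ℚ) * (b (n + (i : ℕ)) : ℚ)
          - 3 * ((dn i).eval (n : ℚ) * (b (n + (i : ℕ)) : ℚ)) := by
      intro i
      simp
      ring
    simp only [e3]
    rw [Finset.sum_sub_distrib, ← Finset.mul_sum, e1, e2, Finset.mul_sum,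
      ← Finset.sum_sub_distrib, ← h]
    refine Finset.sum_congr rfl fun i _ => ?_
    have e4 : n + 1 + (i : ℕ) = n + i + 1 := by ring
    rw [e4, coeff_c]
    simp [R]
    ring
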